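/- Let N be a quantum channel in the relative interior of the set C(H,K) of channels. Then for every l ∈ ℕ, the maximal size M_{EA}(l,N) of a zero-error entanglement-assisted code for N equals 1; consequently the zero-error quantum capacity Q_0(N), the classical zero-error capacity C_0(N), and the entanglement-assisted zero-error capacity C_{0EA}(N) are all 0. -/

import Mathlib

open scoped ComplexOrder

/-- A density operator: positive semidefinite with trace one. -/
def IsState {γ : Type*} [Fintype γ] [DecidableEq γ] (ρ : Matrix γ γ ℂ) : Prop :=
  ρ.PosSemidef ∧ ρ.trace = 1

/-- Kraus characterization of quantum channels (CPTP maps). -/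
def IsCPTP {ι κ : Type*} [Fintype ι] [DecidableEq ι] [Fintype κ] [DecidableEq κ]
    (N : Matrix ι ι ℂ →ₗ[ℂ] Matrix κ κ ℂ) : Prop :=
  ∃ (m : ℕ) (G : Fin m → Matrix κ ι ℂ),
    (∀ a, N a = ∑ j, G j * a * (G j).conjTranspose) ∧
      (∑ j, (G j).conjTranspose * G j = 1)

/-- The elementary tensor `a₁ ⊗ ⋯ ⊗ a_l` of matrices. -/
def elemTensor {ι : Type*} {l : ℕ} (a : Fin l → Matrix ι ι ℂ) :
    Matrix (Fin l → ι) (Fin l → ι) ℂ :=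
  Matrix.of fun x y => ∏ i, a i (x i) (y i)

/-- `Tl` is the `l`-th tensor power `N^{⊗l}` of the superoperator `N` (characterized
by its action on elementary tensors). -/
def IsTensorPow {ι κ : Type*} [Fintype ι] [Fintype κ] (l : ℕ)
    (N : Matrix ι ι ℂ →ₗ[ℂ] Matrix κ κ ℂ)
    (Tl : Matrix (Fin l → ι) (Fin l → ι) ℂ →ₗ[ℂ] Matrix (Fin l → κ) (Fin l → κ) ℂ) :
    Prop :=
  ∀ a : Fin l → Matrix ι ι ℂ, Tl (elemTensor a) = elemTensor fun i => N (a i)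

/-- `Λ ⊗ id`, applied on the first tensor factor of a bipartite operator. -/
def appLeft {F F' G : Type*} (Λ : Matrix F F ℂ →ₗ[ℂ] Matrix G G ℂ)
    (σ : Matrix (F × F') (F × F') ℂ) : Matrix (G × F') (G × F') ℂ :=
  Matrix.of fun p q => Λ (Matrix.of fun f g => σ (f, p.2) (g, q.2)) p.1 q.1

/-- The maximally entangled state vector on `ℂᵏ ⊗ ℂᵏ`. -/
noncomputable def maxEntVec (k : ℕ) : Fin k × Fin k → ℂ :=
  fun p => if p.1 = p.2 then ((1 / Real.sqrt k : ℝ) : ℂ) else 0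

/-- The rank-one projection `|x⟩⟨x|`. -/
noncomputable def rankOneProj {k : ℕ} (x : EuclideanSpace ℂ (Fin k)) :
    Matrix (Fin k) (Fin k) ℂ :=
  Matrix.of fun i j => x i * (starRingEnd ℂ) (x j)

variable {ι κ : Type*} [Fintype ι] [DecidableEq ι] [Fintype κ] [DecidableEq κ]

/-- `k(l,N)`: the maximal dimension of an `(l,k)` zero-error quantum code for `N`. -/
noncomputable def kQuantum (l : ℕ) (N : Matrix ι ι ℂ →ₗ[ℂ] Matrix κ κ ℂ) : ℕ :=
  sSup {k : ℕ | 0 < k ∧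
    ∃ (Tl : Matrix (Fin l → ι) (Fin l → ι) ℂ →ₗ[ℂ] Matrix (Fin l → κ) (Fin l → κ) ℂ)
      (P : Matrix (Fin k) (Fin k) ℂ →ₗ[ℂ] Matrix (Fin l → ι) (Fin l → ι) ℂ)
      (R : Matrix (Fin l → κ) (Fin l → κ) ℂ →ₗ[ℂ] Matrix (Fin k) (Fin k) ℂ),
      IsTensorPow l N Tl ∧ IsCPTP P ∧ IsCPTP R ∧
      ∀ x : EuclideanSpace ℂ (Fin k), ‖x‖ = 1 →
        ∑ i, ∑ j, (starRingEnd ℂ) (x i) * (R (Tl (P (rankOneProj x)))) i j * x j = 1}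

/-- `M(l,N)`: the maximal size of an `(l,M)` zero-error classical code for `N`. -/
noncomputable def mClassical (l : ℕ) (N : Matrix ι ι ℂ →ₗ[ℂ] Matrix κ κ ℂ) : ℕ :=
  sSup {M : ℕ | 0 < M ∧
    ∃ (Tl : Matrix (Fin l → ι) (Fin l → ι) ℂ →ₗ[ℂ] Matrix (Fin l → κ) (Fin l → κ) ℂ)
      (ρ : Fin M → Matrix (Fin l → ι) (Fin l → ι) ℂ)
      (D : Fin M → Matrix (Fin l → κ) (Fin l → κ) ℂ),
      IsTensorPow l N Tl ∧ (∀ m, IsState (ρ m)) ∧ (∀ m, (D m).PosSemidef) ∧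
      (∑ m, D m = 1) ∧ ∀ m, (Tl (ρ m) * D m).trace = 1}

/-- `M_EA(l,N)`: the maximal size of an `(l,M)` zero-error entanglement-assisted
code for `N`. -/
noncomputable def mEA (l : ℕ) (N : Matrix ι ι ℂ →ₗ[ℂ] Matrix κ κ ℂ) : ℕ :=
  sSup {M : ℕ | 0 < M ∧
    ∃ (nF nF' : ℕ)
      (Tl : Matrix (Fin l → ι) (Fin l → ι) ℂ →ₗ[ℂ] Matrix (Fin l → κ) (Fin l → κ) ℂ)
      (σ : Matrix (Fin nF × Fin nF') (Fin nF × Fin nF') ℂ)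
      (P : Fin M → (Matrix (Fin nF) (Fin nF) ℂ →ₗ[ℂ] Matrix (Fin l → ι) (Fin l → ι) ℂ))
      (D : Fin M → Matrix ((Fin l → κ) × Fin nF') ((Fin l → κ) × Fin nF') ℂ),
      IsTensorPow l N Tl ∧ IsState σ ∧ (∀ m, IsCPTP (P m)) ∧
      (∀ m, (D m).PosSemidef) ∧ (∑ m, D m = 1) ∧
      ∀ m, (appLeft (Tl ∘ₗ P m) σ * D m).trace = 1}

/-- The zero-error quantum capacity `Q₀(N) = lim (1/l) log k(l,N)`. -/
noncomputable def Q0 (N : Matrix ι ι ℂ →ₗ[ℂ] Matrix κ κ ℂ) : ℝ :=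
  Filter.limsup (fun l : ℕ => Real.logb 2 (kQuantum l N) / l) Filter.atTop

/-- The classical zero-error capacity `C₀(N) = lim (1/l) log M(l,N)`. -/
noncomputable def C0 (N : Matrix ι ι ℂ →ₗ[ℂ] Matrix κ κ ℂ) : ℝ :=
  Filter.limsup (fun l : ℕ => Real.logb 2 (mClassical l N) / l) Filter.atTop

/-- The entanglement-assisted zero-error capacity `C₀EA(N) = lim (1/l) log M_EA(l,N)`. -/
noncomputable def C0EA (N : Matrix ι ι ℂ →ₗ[ℂ] Matrix κ κ ℂ) : ℝ :=
  Filter.limsup (fun l : ℕ => Real.logb 2 (mEA l N) / l) Filter.atTop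

/-- The algebraic relative interior of a set `s` in a complex vector space: `x ∈ s`
such that every segment from a point of `s` to `x` can be prolonged beyond `x`
within `s`.  For convex sets in finite dimension this is the relative interior. -/
def AlgRelInterior {V : Type*} [AddCommGroup V] [Module ℂ V] (s : Set V) (x : V) :
    Prop :=
  x ∈ s ∧ ∀ y ∈ s, ∃ t : ℝ, 1 < t ∧ y + ((t : ℝ) : ℂ) • (x - y) ∈ s

section Helpers

open Matrix Kronecker

/-- Rectangular tensor product of matrices. -/
def piT {n : ℕ} {α β : Type*} (a : Fin n → Matrix α β ℂ) :
    Matrix (Fin n → α) (Fin n → β) ℂ :=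
  Matrix.of fun x y => ∏ i, a i (x i) (y i)

theorem piT_mul {n : ℕ} {α β γ : Type*} [Fintype β]
    (a : Fin n → Matrix α β ℂ) (b : Fin n → Matrix β γ ℂ) :
    piT a * piT b = piT fun i => a i * b i := by
  classical
  ext x y
  simp only [piT, Matrix.mul_apply, Matrix.of_apply]
  rw [Finset.prod_univ_sum, Fintype.piFinset_univ]
  simp only [Finset.prod_mul_distrib]

theorem piT_conjTranspose {n : ℕ} {α β : Type*} (a : Fin n → Matrix α β ℂ) :
    (piT a)ᴴ = piT fun i => (a i)ᴴ := by
  ext x y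
  simp [piT, Matrix.conjTranspose_apply]

theorem piT_sum {n : ℕ} {α β J : Type*} [Fintype J]
    (a : Fin n → J → Matrix α β ℂ) :
    ∑ j : Fin n → J, piT (fun i => a i (j i)) = piT fun i => ∑ j, a i j := by
  classical
  ext x y
  simp only [piT, Matrix.sum_apply, Matrix.of_apply]
  rw [Finset.prod_univ_sum, Fintype.piFinset_univ]

theorem piT_single {n : ℕ} {α β : Type*} [DecidableEq α] [DecidableEq β]
    (x : Fin n → α) (y : Fin n → β) (s : ℂ) :
    piT (fun i => Matrix.single (x i) (y i) s) = Matrix.single x y (s ^ n) := by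
  ext u v
  simp only [piT, Matrix.of_apply, Matrix.single_apply]
  by_cases h : x = u ∧ y = v
  · obtain ⟨rfl, rfl⟩ := h
    simp
  · rw [if_neg h]
    have : ∃ i, ¬ (x i = u i ∧ y i = v i) := by
      by_contra hc
      push Not at hc
      exact h ⟨funext fun i => (hc i).1, funext fun i => (hc i).2⟩
    obtain ⟨i, hi⟩ := this
    exact Finset.prod_eq_zero (Finset.mem_univ i) (if_neg hi)

theorem piT_one {n : ℕ} {α : Type*} [DecidableEq α] :
    piT (fun _ : Fin n => (1 : Matrix α α ℂ)) = 1 := by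
  classical
  ext u v
  simp only [piT, Matrix.of_apply, Matrix.one_apply]
  by_cases h : u = v
  · subst h; simp
  · rw [if_neg h]
    obtain ⟨i, hi⟩ := Function.ne_iff.mp h
    exact Finset.prod_eq_zero (Finset.mem_univ i) (if_neg hi)

/-- Kraus map. -/
def krausMap {J α β : Type*} [Fintype J] [Fintype α] (G : J → Matrix β α ℂ) :
    Matrix α α ℂ →ₗ[ℂ] Matrix β β ℂ where
  toFun a := ∑ j, G j * a * (G j)ᴴ
  map_add' a b := by simp [Matrix.mul_add, Matrix.add_mul, Finset.sum_add_distrib]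
  map_smul' c a := by simp [Finset.smul_sum]

theorem krausMap_apply {J α β : Type*} [Fintype J] [Fintype α] (G : J → Matrix β α ℂ)
    (a : Matrix α α ℂ) : krausMap G a = ∑ j, G j * a * (G j)ᴴ := rfl

theorem isCPTP_of_kraus {J α β : Type*} [Fintype J] [Fintype α] [DecidableEq α]
    [Fintype β] [DecidableEq β] (G : J → Matrix β α ℂ)
    (h : ∑ j, (G j)ᴴ * G j = 1) : IsCPTP (krausMap G) := by
  refine ⟨Fintype.card J, fun i => G ((Fintype.equivFin J).symm i), fun a => ?_, ?_⟩
  · rw [krausMap_apply]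
    exact ((Fintype.equivFin J).symm.sum_comp (fun j => G j * a * (G j)ᴴ)).symm
  · rw [← h]
    exact (Fintype.equivFin J).symm.sum_comp (fun j => (G j)ᴴ * G j)

theorem IsCPTP.exists_kraus {α β : Type*} [Fintype α] [DecidableEq α]
    [Fintype β] [DecidableEq β] {T : Matrix α α ℂ →ₗ[ℂ] Matrix β β ℂ} (h : IsCPTP T) :
    ∃ (m : ℕ) (G : Fin m → Matrix β α ℂ), T = krausMap G ∧ ∑ j, (G j)ᴴ * G j = 1 := by
  obtain ⟨m, G, h1, h2⟩ := h
  exact ⟨m, G, LinearMap.ext h1, h2⟩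

theorem krausMap_trace {J α β : Type*} [Fintype J] [Fintype α] [DecidableEq α] [Fintype β]
    (G : J → Matrix β α ℂ) (h : ∑ j, (G j)ᴴ * G j = 1) (a : Matrix α α ℂ) :
    (krausMap G a).trace = a.trace := by
  rw [krausMap_apply, Matrix.trace_sum]
  have : ∀ j, (G j * a * (G j)ᴴ).trace = ((G j)ᴴ * G j * a).trace := fun j => by
    rw [Matrix.trace_mul_comm, ← Matrix.mul_assoc]
  simp only [this]
  rw [← Matrix.trace_sum, ← Finset.sum_mul, h, Matrix.one_mul]

theorem krausMap_posSemidef {J α β : Type*} [Fintype J] [Fintype α] [Fintype β]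
    (G : J → Matrix β α ℂ) {a : Matrix α α ℂ} (ha : a.PosSemidef) :
    (krausMap G a).PosSemidef := by
  rw [krausMap_apply]
  exact Matrix.posSemidef_sum _ fun j _ => ha.mul_mul_conjTranspose_same (G j)

/-- Tensor power of a Kraus map. -/
theorem isTensorPow_kraus {J α β : Type*} [Fintype J] [Fintype α] [Fintype β]
    (l : ℕ) (G : J → Matrix β α ℂ) :
    IsTensorPow l (krausMap G) (krausMap fun j : Fin l → J => piT fun i => G (j i)) := by
  intro a
  have e1 : elemTensor a = piT a := rfl
  have e2 : (elemTensor fun i => krausMap G (a i)) = piT fun i => krausMap G (a i) := rfl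
  rw [e1, e2, krausMap_apply]
  simp only [krausMap_apply, piT_conjTranspose, piT_mul]
  exact piT_sum (fun i j => G j * a i * (G j)ᴴ)

theorem isTensorPow_unique {α β : Type*} [Fintype α] [DecidableEq α] [Fintype β]
    {l : ℕ} {N : Matrix α α ℂ →ₗ[ℂ] Matrix β β ℂ}
    {T T' : Matrix (Fin l → α) (Fin l → α) ℂ →ₗ[ℂ] Matrix (Fin l → β) (Fin l → β) ℂ}
    (h : IsTensorPow l N T) (h' : IsTensorPow l N T') : T = T' := by
  refine LinearMap.ext fun a => ?_
  have key : ∀ x y, T (Matrix.single x y 1) = T' (Matrix.single x y 1) := by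
    intro x y
    have e : Matrix.single x y (1 : ℂ) =
        elemTensor (fun i => Matrix.single (x i) (y i) (1 : ℂ)) := by
      have := piT_single x y 1
      rw [one_pow] at this
      exact this.symm
    rw [e, h, h']
  rw [Matrix.matrix_eq_sum_single a]
  simp only [map_sum]
  refine Finset.sum_congr rfl fun x _ => Finset.sum_congr rfl fun y _ => ?_
  have : Matrix.single x y (a x y) = a x y • Matrix.single x y (1 : ℂ) := by
    simp [Matrix.smul_single]
  rw [this, map_smul, map_smul, key]

theorem kraus_piT_one {J α β : Type*} [Fintype J] [Fintype α] [DecidableEq α] [Fintype β]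
    (l : ℕ) (G : J → Matrix β α ℂ) (h : ∑ j, (G j)ᴴ * G j = 1) :
    ∑ j : Fin l → J, (piT fun i => G (j i))ᴴ * (piT fun i => G (j i)) = 1 := by
  simp only [piT_conjTranspose, piT_mul]
  have := piT_sum (n := l) (fun _ j => (G j)ᴴ * G j)
  rw [this, h, piT_one]

/-- `appLeft` of a Kraus map. -/
theorem appLeft_kraus {J α β γ : Type*} [Fintype J] [Fintype α] [Fintype γ] [DecidableEq γ]
    (G : J → Matrix β α ℂ) (σ : Matrix (α × γ) (α × γ) ℂ) :
    appLeft (krausMap G) σ = krausMap (fun j => G j ⊗ₖ (1 : Matrix γ γ ℂ)) σ := by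
  ext ⟨b, f⟩ ⟨b', f'⟩
  simp only [appLeft, krausMap_apply, Matrix.of_apply, Matrix.sum_apply, Matrix.mul_apply,
    Matrix.conjTranspose_apply, Matrix.kroneckerMap_apply, Fintype.sum_prod_type,
    Matrix.one_apply]
  simp [apply_ite (starRingEnd ℂ)]

theorem appLeft_trace {J α β γ : Type*} [Fintype J] [Fintype α] [DecidableEq α] [Fintype β]
    (G : J → Matrix β α ℂ) (h : ∑ j, (G j)ᴴ * G j = 1)
    (σ : Matrix (α × γ) (α × γ) ℂ) (f g : γ) :
    ∑ b, appLeft (krausMap G) σ (b, f) (b, g) = ∑ a, σ (a, f) (a, g) := by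
  have := krausMap_trace G h (Matrix.of fun a a' => σ (a, f) (a', g))
  simpa [Matrix.trace, appLeft] using this

open scoped MatrixOrder Matrix.Norms.L2Operator in
theorem trace_mul_nonneg {γ : Type*} [Fintype γ] {A B : Matrix γ γ ℂ}
    (hA : A.PosSemidef) (hB : B.PosSemidef) : 0 ≤ (A * B).trace := by
  classical
  obtain ⟨C, rfl⟩ := CStarAlgebra.nonneg_iff_eq_star_mul_self.mp hB.nonneg
  rw [Matrix.star_eq_conjTranspose, ← Matrix.mul_assoc, Matrix.trace_mul_comm,
    ← Matrix.mul_assoc]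
  exact (hA.mul_mul_conjTranspose_same C).trace_nonneg

theorem single_term {α β γ : Type*} [Fintype α] [DecidableEq α] [Fintype β] [DecidableEq β]
    [Fintype γ] [DecidableEq γ] (b : β) (a : α) (s : ℂ)
    (ρ : Matrix (α × γ) (α × γ) ℂ) (D : Matrix (β × γ) (β × γ) ℂ) :
    ((Matrix.single b a s ⊗ₖ (1 : Matrix γ γ ℂ)) * ρ *
      (Matrix.single b a s ⊗ₖ (1 : Matrix γ γ ℂ))ᴴ * D).trace =
      s * star s * ∑ f, ∑ g, ρ (a, f) (a, g) * D (b, g) (b, f) := by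
  simp only [Matrix.trace, Matrix.diag, Matrix.mul_apply,
    Matrix.conjTranspose_apply, Matrix.kroneckerMap_apply, Fintype.sum_prod_type,
    Matrix.one_apply, Matrix.single_apply]
  simp [ite_and, apply_ite (starRingEnd ℂ)]
  simp only [Finset.mul_sum]
  refine Finset.sum_congr rfl fun f _ => Finset.sum_congr rfl fun g _ => ?_
  ring

theorem core {J α β γ : Type*} [Fintype J] [Fintype α] [DecidableEq α] [Fintype β]
    [DecidableEq β] [Nonempty β] [Fintype γ] [DecidableEq γ]
    (G : J → Matrix β α ℂ) (h : ∑ j, (G j)ᴴ * G j = 1)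
    (s : ℂ) (hs : s ≠ 0) (hG : ∀ b a, ∃ j, G j = Matrix.single b a s)
    {M : ℕ} (ρ : Fin M → Matrix (α × γ) (α × γ) ℂ) (hρ : ∀ m, (ρ m).PosSemidef)
    (τ : γ → γ → ℂ) (hτ : ∀ m f g, ∑ a, ρ m (a, f) (a, g) = τ f g) (hτ1 : ∑ f, τ f f = 1)
    (D : Fin M → Matrix (β × γ) (β × γ) ℂ) (hD : ∀ m, (D m).PosSemidef)
    (hD1 : ∑ m, D m = 1) (hc : ∀ m, (appLeft (krausMap G) (ρ m) * D m).trace = 1) :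
    M ≤ 1 := by
  by_contra hM
  have hps : ∀ m, (appLeft (krausMap G) (ρ m)).PosSemidef := fun m => by
    rw [appLeft_kraus]; exact krausMap_posSemidef _ (hρ m)
  have htr : ∀ m, (appLeft (krausMap G) (ρ m)).trace = 1 := fun m => by
    rw [Matrix.trace, Fintype.sum_prod_type_right]
    simp only [Matrix.diag, appLeft_trace G h, hτ, hτ1]
  have h0 : ∀ m m', m ≠ m' → (appLeft (krausMap G) (ρ m) * D m').trace = 0 := by
    intro m m' hne
    have e : ∑ k, (appLeft (krausMap G) (ρ m) * D k).trace = 1 := by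
      rw [← Matrix.trace_sum, ← Finset.mul_sum, hD1, Matrix.mul_one, htr]
    rw [← Finset.add_sum_erase _ _ (Finset.mem_univ m), hc] at e
    have e' := add_eq_left.mp e
    rw [Finset.sum_eq_zero_iff_of_nonneg (fun k _ => trace_mul_nonneg (hps m) (hD k))] at e'
    exact e' m' (Finset.mem_erase.mpr ⟨hne.symm, Finset.mem_univ _⟩)
  have h1 : ∀ m m', m ≠ m' → ∀ b a, ∑ f, ∑ g, ρ m (a, f) (a, g) * D m' (b, g) (b, f) = 0 := by
    intro m m' hne b a
    have e := h0 m m' hne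
    rw [appLeft_kraus, krausMap_apply, Finset.sum_mul, Matrix.trace_sum,
      Finset.sum_eq_zero_iff_of_nonneg (fun j _ => trace_mul_nonneg
        ((hρ m).mul_mul_conjTranspose_same _) (hD m'))] at e
    obtain ⟨j, hj⟩ := hG b a
    have e2 := e j (Finset.mem_univ j)
    rw [hj, single_term] at e2
    rcases mul_eq_zero.mp e2 with e3 | e3
    · simp [hs] at e3
    · exact e3
  obtain ⟨b⟩ := ‹Nonempty β›
  have h2 : ∀ m', ∑ f, ∑ g, τ f g * D m' (b, g) (b, f) = 0 := by
    intro m'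
    have : Nontrivial (Fin M) := Fin.nontrivial_iff_two_le.mpr (by omega)
    obtain ⟨m, hm⟩ := exists_ne m'
    have e : ∑ a, ∑ f, ∑ g, ρ m (a, f) (a, g) * D m' (b, g) (b, f) = 0 :=
      Finset.sum_eq_zero fun a _ => h1 m m' hm b a
    rw [← e]
    symm
    rw [Finset.sum_comm]
    refine Finset.sum_congr rfl fun f _ => ?_
    rw [Finset.sum_comm]
    refine Finset.sum_congr rfl fun g _ => ?_
    rw [← hτ m, Finset.sum_mul]
  have h3 : ∑ m', ∑ f, ∑ g, τ f g * D m' (b, g) (b, f) = 1 := by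
    rw [Finset.sum_comm, ← hτ1]
    refine Finset.sum_congr rfl fun f _ => ?_
    rw [Finset.sum_comm]
    simp only [← Finset.mul_sum]
    have : ∀ g, ∑ m', D m' (b, g) (b, f) = (1 : Matrix (β × γ) (β × γ) ℂ) (b, g) (b, f) := by
      intro g; rw [← hD1, Matrix.sum_apply]
    simp [this, Matrix.one_apply]
  rw [Finset.sum_eq_zero fun m' _ => h2 m'] at h3
  exact zero_ne_one h3

theorem depol_one {α β : Type*} [Fintype α] [DecidableEq α] [Fintype β] [DecidableEq β]
    (s : ℂ) :
    ∑ p : β × α, (Matrix.single p.1 p.2 s)ᴴ * Matrix.single p.1 p.2 s =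
      ((Fintype.card β : ℂ) * (star s * s)) • (1 : Matrix α α ℂ) := by
  ext x y
  simp [Fintype.sum_prod_type, Matrix.sum_apply, Matrix.conjTranspose_single,
    Matrix.single_apply, Matrix.one_apply, ite_and]
  split_ifs <;> simp

/-- A relatively interior channel has a Kraus family containing multiples of all matrix units. -/
theorem exists_full_kraus {α β : Type*} [Fintype α] [DecidableEq α] [Fintype β] [DecidableEq β]
    [Nonempty β] {N : Matrix α α ℂ →ₗ[ℂ] Matrix β β ℂ}
    (hN : AlgRelInterior {T : Matrix α α ℂ →ₗ[ℂ] Matrix β β ℂ | IsCPTP T} N) :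
    ∃ (m : ℕ) (G : (Fin m ⊕ β × α) → Matrix β α ℂ) (s : ℂ), N = krausMap G ∧
      ∑ j, (G j)ᴴ * G j = 1 ∧ s ≠ 0 ∧ ∀ b a, ∃ j, G j = Matrix.single b a s := by
  set d : ℝ := (Fintype.card β : ℝ) with hd
  have hd0 : 0 < d := by rw [hd]; exact_mod_cast Fintype.card_pos
  set r : ℝ := Real.sqrt (1 / d) with hr
  have hr2 : r * r = 1 / d := Real.mul_self_sqrt (by positivity)
  have hr0 : 0 < r := Real.sqrt_pos.mpr (by positivity)
  have hE : ∑ p : β × α, (Matrix.single p.1 p.2 (r : ℂ))ᴴ * Matrix.single p.1 p.2 (r : ℂ) = 1 := by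
    rw [depol_one]
    have : ((Fintype.card β : ℂ) * (star (r : ℂ) * r)) = 1 := by
      have e : d * (r * r) = 1 := by rw [hr2]; field_simp
      have : star (r : ℂ) = r := Complex.conj_ofReal r
      rw [this]
      exact_mod_cast e
    rw [this, one_smul]
  obtain ⟨t, ht, hZ⟩ := hN.2 _ (isCPTP_of_kraus _ hE)
  obtain ⟨m, Z, hZ1, hZ2⟩ := IsCPTP.exists_kraus hZ
  set u : ℝ := Real.sqrt (1 / t) with hu
  set v : ℝ := Real.sqrt ((t - 1) / t) with hv
  have hu2 : u * u = 1 / t := Real.mul_self_sqrt (by positivity)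
  have hv2 : v * v = (t - 1) / t := Real.mul_self_sqrt (div_nonneg (by linarith) (by linarith))
  have hv0 : 0 < v := Real.sqrt_pos.mpr (div_pos (by linarith) (by linarith))
  have ht0 : (t : ℂ) ≠ 0 := by exact_mod_cast (by linarith : t ≠ 0)
  have hu2c : (u : ℂ) * u = 1 / t := by exact_mod_cast hu2
  have hv2c : (v : ℂ) * v = (t - 1) / t := by exact_mod_cast hv2
  refine ⟨m, Sum.elim (fun j => (u : ℂ) • Z j)
    (fun p => (v : ℂ) • Matrix.single p.1 p.2 (r : ℂ)), (v : ℂ) * r, ?_, ?_, ?_, ?_⟩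
  · refine LinearMap.ext fun a => ?_
    have e := LinearMap.congr_fun hZ1 a
    rw [krausMap_apply, Fintype.sum_sum_type]
    simp only [Sum.elim_inl, Sum.elim_inr, Matrix.conjTranspose_smul, Matrix.smul_mul,
      Matrix.mul_smul, smul_smul, ← Finset.smul_sum]
    simp only [← krausMap_apply] at e ⊢
    have su : star (u : ℂ) = u := Complex.conj_ofReal u
    have sv : star (v : ℂ) = v := Complex.conj_ofReal v
    rw [su, sv, hu2c, hv2c, ← e]
    simp only [LinearMap.add_apply, LinearMap.smul_apply, LinearMap.sub_apply]
    match_scalars <;> field_simp <;> ring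
  · rw [Fintype.sum_sum_type]
    simp only [Sum.elim_inl, Sum.elim_inr, Matrix.conjTranspose_smul, Matrix.smul_mul,
      Matrix.mul_smul, smul_smul, ← Finset.smul_sum]
    have su : star (u : ℂ) = u := Complex.conj_ofReal u
    have sv : star (v : ℂ) = v := Complex.conj_ofReal v
    rw [su, sv, hu2c, hv2c, hE, hZ2, ← add_smul]
    have : (1 / t + (t - 1) / t : ℂ) = 1 := by field_simp; ring
    rw [this, one_smul]
  · have : v * r ≠ 0 := by positivity
    exact_mod_cast this
  · intro b a
    exact ⟨Sum.inr (b, a), by simp [Matrix.smul_single]⟩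

/-- The same for tensor powers. -/
theorem exists_full_kraus_pow {α β : Type*} [Fintype α] [DecidableEq α] [Fintype β]
    [DecidableEq β] [Nonempty β] {N : Matrix α α ℂ →ₗ[ℂ] Matrix β β ℂ}
    (hN : AlgRelInterior {T : Matrix α α ℂ →ₗ[ℂ] Matrix β β ℂ | IsCPTP T} N) (l : ℕ) :
    ∃ (m : ℕ) (G : (Fin l → Fin m ⊕ β × α) → Matrix (Fin l → β) (Fin l → α) ℂ) (s : ℂ),
      IsTensorPow l N (krausMap G) ∧
      ∑ j, (G j)ᴴ * G j = 1 ∧ s ≠ 0 ∧ ∀ b a, ∃ j, G j = Matrix.single b a s := by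
  obtain ⟨m, G, s, h1, h2, h3, h4⟩ := exists_full_kraus hN
  refine ⟨m, fun j => piT fun i => G (j i), s ^ l, ?_, kraus_piT_one l G h2,
    pow_ne_zero _ h3, fun b a => ?_⟩
  · rw [h1]; exact isTensorPow_kraus l G
  · choose j hj using fun i => h4 (b i) (a i)
    exact ⟨j, by simp only [hj, piT_single]⟩

theorem ea_le {N : Matrix ι ι ℂ →ₗ[ℂ] Matrix κ κ ℂ} [Nonempty κ]
    (hN : AlgRelInterior {T : Matrix ι ι ℂ →ₗ[ℂ] Matrix κ κ ℂ | IsCPTP T} N) (l M nF nF' : ℕ)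
      (Tl : Matrix (Fin l → ι) (Fin l → ι) ℂ →ₗ[ℂ] Matrix (Fin l → κ) (Fin l → κ) ℂ)
      (σ : Matrix (Fin nF × Fin nF') (Fin nF × Fin nF') ℂ)
      (P : Fin M → (Matrix (Fin nF) (Fin nF) ℂ →ₗ[ℂ] Matrix (Fin l → ι) (Fin l → ι) ℂ))
      (D : Fin M → Matrix ((Fin l → κ) × Fin nF') ((Fin l → κ) × Fin nF') ℂ)
      (hT : IsTensorPow l N Tl) (hσ : IsState σ) (hP : ∀ m, IsCPTP (P m))
      (hD : ∀ m, (D m).PosSemidef) (hD1 : ∑ m, D m = 1)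
      (hc : ∀ m, (appLeft (Tl ∘ₗ P m) σ * D m).trace = 1) : M ≤ 1 := by
  obtain ⟨m, G, s, h1, h2, h3, h4⟩ := exists_full_kraus_pow hN l
  obtain rfl := isTensorPow_unique hT h1
  refine core G h2 s h3 h4 (fun m => appLeft (P m) σ) (fun m => ?_)
    (fun f g => ∑ a, σ (a, f) (a, g)) (fun m f g => ?_) ?_ D hD hD1 hc
  · obtain ⟨_, K, hK, _⟩ := (hP m).exists_kraus
    rw [hK, appLeft_kraus]
    exact krausMap_posSemidef _ hσ.1
  · obtain ⟨_, K, hK, hK1⟩ := (hP m).exists_kraus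
    rw [hK]
    exact appLeft_trace K hK1 σ f g
  · rw [← hσ.2, Matrix.trace, Fintype.sum_prod_type_right]
    rfl

theorem cl_le {N : Matrix ι ι ℂ →ₗ[ℂ] Matrix κ κ ℂ} [Nonempty κ]
    (hN : AlgRelInterior {T : Matrix ι ι ℂ →ₗ[ℂ] Matrix κ κ ℂ | IsCPTP T} N) (l M : ℕ)
      (Tl : Matrix (Fin l → ι) (Fin l → ι) ℂ →ₗ[ℂ] Matrix (Fin l → κ) (Fin l → κ) ℂ)
      (ρ : Fin M → Matrix (Fin l → ι) (Fin l → ι) ℂ)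
      (D : Fin M → Matrix (Fin l → κ) (Fin l → κ) ℂ)
      (hT : IsTensorPow l N Tl) (hρ : ∀ m, IsState (ρ m)) (hD : ∀ m, (D m).PosSemidef)
      (hD1 : ∑ m, D m = 1) (hc : ∀ m, (Tl (ρ m) * D m).trace = 1) : M ≤ 1 := by
  obtain ⟨m, G, s, h1, h2, h3, h4⟩ := exists_full_kraus_pow hN l
  obtain rfl := isTensorPow_unique hT h1
  refine core (γ := Unit) G h2 s h3 h4 (fun m => (ρ m).submatrix Prod.fst Prod.fst)
    (fun m => (hρ m).1.submatrix _)
    (fun _ _ => 1) (fun m f g => (hρ m).2) (by simp)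
    (fun m => (D m).submatrix Prod.fst Prod.fst) (fun m => (hD m).submatrix _) ?_ (fun m => ?_)
  · ext ⟨x, _⟩ ⟨y, _⟩
    have := congrFun (congrFun hD1 x) y
    simp only [Matrix.sum_apply, Matrix.submatrix_apply] at this ⊢
    rw [this]
    simp [Matrix.one_apply]
  · rw [← hc m]
    simp only [Matrix.trace, Matrix.diag, Matrix.mul_apply, Fintype.sum_prod_type]
    simp [appLeft]
    rfl

theorem qu_le {N : Matrix ι ι ℂ →ₗ[ℂ] Matrix κ κ ℂ} [Nonempty κ]
    (hN : AlgRelInterior {T : Matrix ι ι ℂ →ₗ[ℂ] Matrix κ κ ℂ | IsCPTP T} N) (l k : ℕ)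
      (Tl : Matrix (Fin l → ι) (Fin l → ι) ℂ →ₗ[ℂ] Matrix (Fin l → κ) (Fin l → κ) ℂ)
      (P : Matrix (Fin k) (Fin k) ℂ →ₗ[ℂ] Matrix (Fin l → ι) (Fin l → ι) ℂ)
      (R : Matrix (Fin l → κ) (Fin l → κ) ℂ →ₗ[ℂ] Matrix (Fin k) (Fin k) ℂ)
      (hT : IsTensorPow l N Tl) (hP : IsCPTP P) (hR : IsCPTP R)
      (hc : ∀ x : EuclideanSpace ℂ (Fin k), ‖x‖ = 1 →
        ∑ i, ∑ j, (starRingEnd ℂ) (x i) * (R (Tl (P (rankOneProj x)))) i j * x j = 1) :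
      k ≤ 1 := by
  obtain ⟨_, K, rfl, hK⟩ := hP.exists_kraus
  obtain ⟨_, S, rfl, hS⟩ := hR.exists_kraus
  have hpos : ∀ i : Fin k, (Matrix.single i i (1 : ℂ)).PosSemidef := fun i => by
    have := Matrix.posSemidef_conjTranspose_mul_self (Matrix.single i i (1 : ℂ))
    simpa [Matrix.conjTranspose_single] using this
  have hsum : ∑ i : Fin k, Matrix.single i i (1 : ℂ) = 1 := by
    ext x y
    simp [Matrix.sum_apply, Matrix.single_apply, Matrix.one_apply, ite_and]
  refine cl_le hN l k Tl (fun i => krausMap K (Matrix.single i i 1))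
    (fun i => ∑ j, (S j)ᴴ * Matrix.single i i (1 : ℂ) * S j) hT (fun i => ⟨?_, ?_⟩) (fun i => ?_) ?_
    (fun i => ?_)
  · exact krausMap_posSemidef _ (hpos i)
  · rw [krausMap_trace _ hK]; simp
  · exact Matrix.posSemidef_sum _ fun j _ => (hpos i).conjTranspose_mul_mul_same _
  · rw [Finset.sum_comm]
    rw [← hS]
    refine Finset.sum_congr rfl fun j _ => ?_
    rw [← Matrix.sum_mul, ← Matrix.mul_sum, hsum, Matrix.mul_one]
  · have e := hc (EuclideanSpace.single i 1) (by simp)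
    have hr : rankOneProj (EuclideanSpace.single i (1 : ℂ)) = Matrix.single i i 1 := by
      ext x y
      simp [rankOneProj, Matrix.single_apply, Pi.single_apply, ite_and, eq_comm]
      split_ifs <;> rfl
    rw [hr] at e
    set X := Tl (krausMap K (Matrix.single i i 1)) with hX
    have e' : (krausMap S X * Matrix.single i i 1).trace = 1 := by
      refine Eq.trans ?_ e
      simp [Matrix.trace_mul_single]
    refine Eq.trans ?_ e'
    rw [krausMap_apply, Finset.mul_sum, Finset.sum_mul, Matrix.trace_sum, Matrix.trace_sum]
    refine Finset.sum_congr rfl fun j _ => ?_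
    rw [Matrix.mul_assoc (S j), Matrix.mul_assoc (S j), Matrix.trace_mul_comm (S j)]
    simp only [Matrix.mul_assoc]

theorem ea_one {N : Matrix ι ι ℂ →ₗ[ℂ] Matrix κ κ ℂ} [Nonempty ι] [Nonempty κ]
    (hN : AlgRelInterior {T : Matrix ι ι ℂ →ₗ[ℂ] Matrix κ κ ℂ | IsCPTP T} N) (l : ℕ) :
    mEA l N = 1 := by
  refine le_antisymm (csSup_le' ?_) (le_csSup ⟨1, ?_⟩ ?_)
  · rintro M ⟨-, nF, nF', Tl, σ, P, D, h1, h2, h3, h4, h5, h6⟩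
    exact ea_le hN l M nF nF' Tl σ P D h1 h2 h3 h4 h5 h6
  · rintro M ⟨-, nF, nF', Tl, σ, P, D, h1, h2, h3, h4, h5, h6⟩
    exact ea_le hN l M nF nF' Tl σ P D h1 h2 h3 h4 h5 h6
  · obtain ⟨m, G, s, h1, h2, h3, h4⟩ := exists_full_kraus_pow hN l
    obtain ⟨x⟩ : Nonempty (Fin l → ι) := inferInstance
    let K : Unit → Matrix (Fin l → ι) (Fin 1) ℂ := fun _ => Matrix.single x 0 1
    have hK : ∑ j, (K j)ᴴ * K j = 1 := by
      ext a b
      simp [K, Matrix.conjTranspose_single, Matrix.single_apply, Matrix.one_apply,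
        Subsingleton.elim a 0, Subsingleton.elim b 0]
    refine ⟨one_pos, 1, 1, krausMap G, 1, fun _ => krausMap K, fun _ => 1, h1,
      ⟨Matrix.PosSemidef.one, by simp⟩, fun _ => isCPTP_of_kraus K hK,
      fun _ => Matrix.PosSemidef.one, by simp, fun _ => ?_⟩
    rw [Matrix.mul_one]
    have e : ∀ σ : Matrix (Fin 1 × Fin 1) (Fin 1 × Fin 1) ℂ,
      appLeft (krausMap G ∘ₗ krausMap K) σ = appLeft (krausMap G) (appLeft (krausMap K) σ) :=
      fun _ => rfl
    rw [e, Matrix.trace, Fintype.sum_prod_type_right]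
    simp only [Matrix.diag, appLeft_trace G h2, appLeft_trace K hK]
    simp

theorem logb_zero_of_le {n : ℕ} (h : n ≤ 1) : Real.logb 2 (n : ℝ) = 0 := by
  interval_cases n <;> simp

end Helpers

/-- for a channel `N` in the relative interior of the set of channels,
`M_EA(l,N) = 1` for every `l`; consequently `Q₀(N) = C₀(N) = C₀EA(N) = 0`. -/
theorem stmt_11 [Nonempty ι] [Nonempty κ] (N : Matrix ι ι ℂ →ₗ[ℂ] Matrix κ κ ℂ)
    (hN : AlgRelInterior {T : Matrix ι ι ℂ →ₗ[ℂ] Matrix κ κ ℂ | IsCPTP T} N) :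
    (∀ l : ℕ, 0 < l → mEA l N = 1) ∧ Q0 N = 0 ∧ C0 N = 0 ∧ C0EA N = 0 := by
  refine ⟨fun l _ => ea_one hN l, ?_, ?_, ?_⟩
  · have : ∀ l, kQuantum l N ≤ 1 := fun l => csSup_le' (by
      rintro k ⟨-, Tl, P, R, h1, h2, h3, h4⟩
      exact qu_le hN l k Tl P R h1 h2 h3 h4)
    simp only [Q0, logb_zero_of_le (this _), zero_div, Filter.limsup_const]
  · have : ∀ l, mClassical l N ≤ 1 := fun l => csSup_le' (by
      rintro k ⟨-, Tl, P, R, h1, h2, h3, h4, h5⟩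
      exact cl_le hN l k Tl P R h1 h2 h3 h4 h5)
    simp only [C0, logb_zero_of_le (this _), zero_div, Filter.limsup_const]
  · have : ∀ l, mEA l N ≤ 1 := fun l => (ea_one hN l).le
    simp only [C0EA, logb_zero_of_le (this _), zero_div, Filter.limsup_const]
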